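/- In R = ℤ[i]/(2^n), the number of distinct annihilator ideals ann(x) = {y ∈ R : xy = 0} as x ranges over the nonzero zero-divisors of R is exactly 2n − 1; moreover two nonzero zero-divisors x and y have ann(x) = ann(y) if and only if x and y are associates, so the equivalence classes are precisely the associate classes V_{d_1}, …, V_{d_{2n−1}}. -/

import Mathlib

/-- The ring `ℤ[i]/(2^n)` of Gaussian integers modulo `2^n`. -/
abbrev Rmod (n : ℕ) : Type := GaussianInt ⧸ Ideal.span {(2 : GaussianInt) ^ n}

/-- The image in `ℤ[i]/(2^n)` of the divisor `d_j = (1+i)^(2n-j)` of `2^n`. -/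
def dElt (n j : ℕ) : Rmod n :=
  Ideal.Quotient.mk _ ((1 + ⟨0, 1⟩ : GaussianInt) ^ (2 * n - j))

/-- The associate class `V_{d_j} = {u • d_j : u a unit}` in `ℤ[i]/(2^n)`. -/
def Vclass (n j : ℕ) : Set (Rmod n) :=
  {x | ∃ u : (Rmod n)ˣ, x = (u : Rmod n) * dElt n j}

section UniserialRing

variable {R : Type*} [CommRing R] {p : R} {N : ℕ}

/-- If every element is a unit or a multiple of `p`, every element is either a unit times a
power of `p` with exponent below `N`, or a multiple of `p ^ N`. -/
theorem exists_units_mul_pow_or_dvd (h : ∀ x : R, p ∣ x ∨ IsUnit x) (x : R) (N : ℕ) :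
    (∃ k < N, ∃ u : Rˣ, x = u * p ^ k) ∨ p ^ N ∣ x := by
  induction N with
  | zero => simp
  | succ N ih =>
    rcases ih with ⟨k, hk, hu⟩ | ⟨y, rfl⟩
    · exact .inl ⟨k, by omega, hu⟩
    · rcases h y with ⟨z, rfl⟩ | ⟨u, rfl⟩
      · exact .inr ⟨z, by ring⟩
      · exact .inl ⟨N, by omega, u, by ring⟩

theorem exists_units_mul_pow_of_ne_zero (h : ∀ x : R, p ∣ x ∨ IsUnit x)
    (hp : ∀ m, p ^ m = 0 ↔ N ≤ m) {x : R} (hx : x ≠ 0) : ∃ k < N, ∃ u : Rˣ, x = u * p ^ k := by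
  refine (exists_units_mul_pow_or_dvd h x N).resolve_right fun hd ↦ hx ?_
  rwa [(hp N).2 le_rfl, zero_dvd_iff] at hd

theorem exists_units_mul_pow_of_zero_divisor (h : ∀ x : R, p ∣ x ∨ IsUnit x)
    (hp : ∀ m, p ^ m = 0 ↔ N ≤ m) {x : R} (hx : x ≠ 0) (hz : ∃ z, z ≠ 0 ∧ x * z = 0) :
    ∃ k, 1 ≤ k ∧ k < N ∧ ∃ u : Rˣ, x = u * p ^ k := by
  obtain ⟨k, hk, u, rfl⟩ := exists_units_mul_pow_of_ne_zero h hp hx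
  refine ⟨k, Nat.one_le_iff_ne_zero.2 ?_, hk, u, rfl⟩
  rintro rfl
  obtain ⟨z, hz0, hz⟩ := hz
  simp_all

theorem setOf_units_mul_mul_eq_zero (u : Rˣ) (a : R) :
    {z | (u : R) * a * z = 0} = {z | a * z = 0} := by
  ext z
  simp [mul_assoc]

theorem le_of_setOf_pow_mul_subset (hp : ∀ m, p ^ m = 0 ↔ N ≤ m) {k m : ℕ} (hk : k ≤ N)
    (h : {z | p ^ k * z = 0} ⊆ {z | p ^ m * z = 0}) : k ≤ m := by
  have hmem : p ^ m * p ^ (N - k) = 0 := h (a := p ^ (N - k)) (by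
    rw [Set.mem_ofPred_eq, ← pow_add, hp]
    omega)
  rw [← pow_add, hp] at hmem
  omega

theorem setOf_mul_eq_zero_eq_iff_associated (h : ∀ x : R, p ∣ x ∨ IsUnit x)
    (hp : ∀ m, p ^ m = 0 ↔ N ≤ m) {x y : R} (hx : x ≠ 0) (hy : y ≠ 0) :
    {z | x * z = 0} = {z | y * z = 0} ↔ ∃ u : Rˣ, y = u * x := by
  constructor
  · obtain ⟨k, hk, u, rfl⟩ := exists_units_mul_pow_of_ne_zero h hp hx
    obtain ⟨m, hm, v, rfl⟩ := exists_units_mul_pow_of_ne_zero h hp hy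
    rw [setOf_units_mul_mul_eq_zero, setOf_units_mul_mul_eq_zero]
    intro he
    obtain rfl : k = m := le_antisymm (le_of_setOf_pow_mul_subset hp hk.le he.subset)
      (le_of_setOf_pow_mul_subset hp hm.le he.superset)
    exact ⟨v * u⁻¹, by simp [mul_assoc]⟩
  · rintro ⟨u, rfl⟩
    exact (setOf_units_mul_mul_eq_zero u x).symm

theorem card_annihilators_of_zero_divisors (h : ∀ x : R, p ∣ x ∨ IsUnit x)
    (hp : ∀ m, p ^ m = 0 ↔ N ≤ m) :
    Nat.card ↥{A : Set R | ∃ x : R,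
      x ≠ 0 ∧ (∃ y, y ≠ 0 ∧ x * y = 0) ∧ A = {y | x * y = 0}} = N - 1 := by
  have himage : {A : Set R | ∃ x : R,
      x ≠ 0 ∧ (∃ y, y ≠ 0 ∧ x * y = 0) ∧ A = {y | x * y = 0}} =
      (fun k ↦ {y | p ^ k * y = 0}) '' Set.Ico 1 N := by
    ext A
    constructor
    · rintro ⟨x, hx, hz, rfl⟩
      obtain ⟨k, hk1, hk, u, rfl⟩ := exists_units_mul_pow_of_zero_divisor h hp hx hz
      exact ⟨k, ⟨hk1, hk⟩, (setOf_units_mul_mul_eq_zero u _).symm⟩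
    · rintro ⟨k, ⟨hk1, hk⟩, rfl⟩
      refine ⟨p ^ k, ?_, ⟨p ^ (N - k), ?_, ?_⟩, rfl⟩
      · rw [Ne, hp]
        omega
      · rw [Ne, hp]
        omega
      · rw [← pow_add, hp]
        omega
  have hinj : Set.InjOn (fun k ↦ {y | p ^ k * y = 0}) (Set.Ico 1 N) := fun k hk m hm he ↦
    le_antisymm (le_of_setOf_pow_mul_subset hp hk.2.le he.subset)
      (le_of_setOf_pow_mul_subset hp hm.2.le he.superset)
  rw [himage, Nat.card_image_of_injOn hinj]
  simp

end UniserialRing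

section GaussianInt

theorem GaussianInt.one_add_I_pow_two_mul (n : ℕ) :
    (1 + ⟨0, 1⟩ : GaussianInt) ^ (2 * n) = 2 ^ n * ⟨0, 1⟩ ^ n := by
  rw [pow_mul, ← mul_pow]
  congr 1

theorem GaussianInt.one_add_I_dvd_or (x : GaussianInt) :
    (1 + ⟨0, 1⟩ : GaussianInt) ∣ x ∨ ∃ y, x = 1 + (1 + ⟨0, 1⟩) * y := by
  obtain ⟨a, b⟩ := x
  rcases Int.even_or_odd' (a + b) with ⟨c, hc | hc⟩
  · refine .inl ⟨⟨c, b - c⟩, ?_⟩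
    ext
    · simp; omega
    · simp
  · refine .inr ⟨⟨c, b - c⟩, ?_⟩
    ext
    · simp; omega
    · simp

theorem GaussianInt.two_pow_dvd_one_add_I_pow_iff (n m : ℕ) :
    (2 : GaussianInt) ^ n ∣ (1 + ⟨0, 1⟩) ^ m ↔ 2 * n ≤ m := by
  constructor
  · intro h
    have hnorm := map_dvd Zsqrtd.normMonoidHom h
    rw [map_pow, map_pow, show Zsqrtd.normMonoidHom (2 : GaussianInt) = 2 ^ 2 from rfl,
      show Zsqrtd.normMonoidHom (1 + ⟨0, 1⟩ : GaussianInt) = 2 from rfl, ← pow_mul] at hnorm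
    exact (pow_dvd_pow_iff (by norm_num) (by decide)).1 hnorm
  · intro h
    exact (Dvd.intro _ (one_add_I_pow_two_mul n).symm).trans (pow_dvd_pow _ h)

theorem Rmod.mk_one_add_I_pow_eq_zero_iff (n m : ℕ) :
    (Ideal.Quotient.mk _ (1 + ⟨0, 1⟩ : GaussianInt) : Rmod n) ^ m = 0 ↔ 2 * n ≤ m := by
  rw [← map_pow, Ideal.Quotient.eq_zero_iff_mem, Ideal.mem_span_singleton,
    GaussianInt.two_pow_dvd_one_add_I_pow_iff]

theorem Rmod.mk_one_add_I_dvd_or_isUnit (n : ℕ) (x : Rmod n) :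
    (Ideal.Quotient.mk _ (1 + ⟨0, 1⟩ : GaussianInt) : Rmod n) ∣ x ∨ IsUnit x := by
  obtain ⟨a, rfl⟩ := Ideal.Quotient.mk_surjective x
  rcases GaussianInt.one_add_I_dvd_or a with h | ⟨y, rfl⟩
  · exact .inl (map_dvd _ h)
  · right
    rw [map_add, map_one, map_mul]
    have hnil : IsNilpotent (Ideal.Quotient.mk _ (1 + ⟨0, 1⟩ : GaussianInt) : Rmod n) :=
      ⟨2 * n, (Rmod.mk_one_add_I_pow_eq_zero_iff n _).2 le_rfl⟩
    exact ((Commute.all _ _).isNilpotent_mul_right hnil).isUnit_one_add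

end GaussianInt

theorem stmt_17 (n : ℕ) (hn : 2 ≤ n) :
    Nat.card ↥{A : Set (Rmod n) | ∃ x : Rmod n,
        x ≠ 0 ∧ (∃ y, y ≠ 0 ∧ x * y = 0) ∧ A = {y | x * y = 0}} = 2 * n - 1 ∧
    (∀ x y : Rmod n, x ≠ 0 → (∃ z, z ≠ 0 ∧ x * z = 0) →
        y ≠ 0 → (∃ z, z ≠ 0 ∧ y * z = 0) →
      ({z | x * z = 0} = {z | y * z = 0} ↔ ∃ u : (Rmod n)ˣ, y = (u : Rmod n) * x)) ∧
    (∀ x : Rmod n, x ≠ 0 → (∃ z, z ≠ 0 ∧ x * z = 0) →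
      ∃ j, 1 ≤ j ∧ j ≤ 2 * n - 1 ∧ x ∈ Vclass n j) := by
  have h := Rmod.mk_one_add_I_dvd_or_isUnit n
  have hp := Rmod.mk_one_add_I_pow_eq_zero_iff n
  refine ⟨card_annihilators_of_zero_divisors h hp,
    fun x y hx _ hy _ ↦ setOf_mul_eq_zero_eq_iff_associated h hp hx hy, fun x hx hz ↦ ?_⟩
  obtain ⟨k, hk1, hk, u, rfl⟩ := exists_units_mul_pow_of_zero_divisor h hp hx hz
  refine ⟨2 * n - k, by omega, by omega, u, ?_⟩
  rw [dElt, map_pow, Nat.sub_sub_self hk.le]
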